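/- Change of variables in the odd variables only, with even parameters: Let U ⊆ ℝ^m be open and let φ = (φ₁,…,φₙ), where φ_k(y,ω) = Σ_{c∈{0,1}^n, |c| odd} ω^c g̃_{k,c}(y) with g_{k,c} ∈ C^∞(U, Λ) taking values of parity (|c|+1) mod 2 (so each φ_k is odd with no ω-free term), and assume the n×n matrix ((∂_{ω_j}φ_k)(y,ω)|_{ω=0}), with entries in the even part, is invertible for every y. Then the matrix (∂_{ω_j}φ_k(y,ω)) is invertible over the commutative even part, and for every supersmooth u(x,θ) = Σ_{a∈{0,1}^n} θ^a f̃_a(x) and every y: ∫dθ u(y,θ) = ∫dω (det(∂φ(y,ω)/∂ω))^{-1}·u(y, φ(y,ω)), where ∫dθ (resp. ∫dω) extracts the coefficient of θ₁⋯θₙ (resp. ω₁⋯ωₙ) after expansion, and u(y, φ(y,ω)) is the substitution θ_k ↦ φ_k(y,ω). Consequently, whenever the coefficient functions are integrable, the change-of-variables formula ∬ dxdθ u(x,θ) = ∬ dydω (det(∂φ/∂ω))^{-1}·u(y, φ(y,ω)) holds for the naive Berezin integral under the change H(y,ω) = (y, φ(y,ω)). -/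

import Mathlib

set_option synthInstance.maxHeartbeats 1000000
set_option maxHeartbeats 4000000

noncomputable section

open MeasureTheory

/-- Index type for the Grassmann generators: `L` generators `σ` (generating `Λ`) and three
banks of `n` odd generators (`θ₁,…,θₙ`, `ω₁,…,ωₙ`, `ϑ₁,…,ϑₙ`). -/
abbrev GIdx (L n : ℕ) : Type := Fin L ⊕ (Fin n ⊕ (Fin n ⊕ Fin n))

/- `E` is the (finite-dimensional) complex Grassmann algebra on the generators indexed by
`GIdx L n`, realized as a normed algebra identified with the exterior algebra via an algebra
isomorphism `g`. -/
variable {L m n : ℕ} {E : Type} [NormedRing E] [NormedAlgebra ℂ E] [CompleteSpace E]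

/-- A generator of `E` attached to a vector. -/
def gen (g : ExteriorAlgebra ℂ (GIdx L n → ℂ) ≃ₐ[ℂ] E) (v : GIdx L n → ℂ) : E :=
  g (ExteriorAlgebra.ι ℂ v)

/-- The generators `σ_i` of `Λ`. -/
def σg (g : ExteriorAlgebra ℂ (GIdx L n → ℂ) ≃ₐ[ℂ] E) (i : Fin L) : E :=
  gen g (Pi.single (Sum.inl i) 1)

/-- The odd generators `θ_k`. -/
def θg (g : ExteriorAlgebra ℂ (GIdx L n → ℂ) ≃ₐ[ℂ] E) (k : Fin n) : E :=
  gen g (Pi.single (Sum.inr (Sum.inl k)) 1)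

/-- The odd generators `ω_k`. -/
def ωg (g : ExteriorAlgebra ℂ (GIdx L n → ℂ) ≃ₐ[ℂ] E) (k : Fin n) : E :=
  gen g (Pi.single (Sum.inr (Sum.inr (Sum.inl k))) 1)

/-- The odd generators `ϑ_k`. -/
def ϑg (g : ExteriorAlgebra ℂ (GIdx L n → ℂ) ≃ₐ[ℂ] E) (k : Fin n) : E :=
  gen g (Pi.single (Sum.inr (Sum.inr (Sum.inr k))) 1)

/-- The even part `E_ev`. -/
def evenPart (g : ExteriorAlgebra ℂ (GIdx L n → ℂ) ≃ₐ[ℂ] E) : Submodule ℂ E :=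
  (CliffordAlgebra.evenOdd (0 : QuadraticForm ℂ (GIdx L n → ℂ)) 0).map g.toLinearMap

/-- The odd part `E_od`. -/
def oddPart (g : ExteriorAlgebra ℂ (GIdx L n → ℂ) ≃ₐ[ℂ] E) : Submodule ℂ E :=
  (CliffordAlgebra.evenOdd (0 : QuadraticForm ℂ (GIdx L n → ℂ)) 1).map g.toLinearMap

/-- The subalgebra `Λ ⊆ E` generated by the `σ`'s. -/
def ΛSub (g : ExteriorAlgebra ℂ (GIdx L n → ℂ) ≃ₐ[ℂ] E) : Subalgebra ℂ E :=
  Algebra.adjoin ℂ (Set.range (σg g))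

/-- The subalgebra of `E` generated by the `σ`'s and the `ϑ`'s. -/
def ΛϑSub (g : ExteriorAlgebra ℂ (GIdx L n → ℂ) ≃ₐ[ℂ] E) : Subalgebra ℂ E :=
  Algebra.adjoin ℂ (Set.range (σg g) ∪ Set.range (ϑg g))

/-- The body map `π_B : E → ℂ`. -/
def πB (g : ExteriorAlgebra ℂ (GIdx L n → ℂ) ≃ₐ[ℂ] E) : E →ₐ[ℂ] ℂ :=
  (ExteriorAlgebra.algebraMapInv).comp g.symm.toAlgHom

/-- The soul `x_S = x − π_B(x)·1` (nilpotent). -/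
def soul (g : ExteriorAlgebra ℂ (GIdx L n → ℂ) ≃ₐ[ℂ] E) (x : E) : E :=
  x - algebraMap ℂ E (πB g x)

/-- Contraction (left odd derivative) with respect to the generator indexed by `idx`. -/
def Dop (g : ExteriorAlgebra ℂ (GIdx L n → ℂ) ≃ₐ[ℂ] E) (idx : GIdx L n) : E →ₗ[ℂ] E :=
  g.toLinearMap ∘ₗ
    (CliffordAlgebra.contractLeft (Q := (0 : QuadraticForm ℂ (GIdx L n → ℂ)))
      (LinearMap.proj idx)) ∘ₗ g.symm.toLinearMap

/-- `∂_{θ_k}`. -/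
def Dθ (g : ExteriorAlgebra ℂ (GIdx L n → ℂ) ≃ₐ[ℂ] E) (k : Fin n) : E →ₗ[ℂ] E :=
  Dop g (Sum.inr (Sum.inl k))

/-- `∂_{ω_k}`. -/
def Dω (g : ExteriorAlgebra ℂ (GIdx L n → ℂ) ≃ₐ[ℂ] E) (k : Fin n) : E →ₗ[ℂ] E :=
  Dop g (Sum.inr (Sum.inr (Sum.inl k)))

/-- `∂_{ϑ_k}`. -/
def Dϑ (g : ExteriorAlgebra ℂ (GIdx L n → ℂ) ≃ₐ[ℂ] E) (k : Fin n) : E →ₗ[ℂ] E :=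
  Dop g (Sum.inr (Sum.inr (Sum.inr k)))

/-- The linear projection on generators keeping only the indices where `keep` is `true`. -/
def keepLin (L n : ℕ) (keep : GIdx L n → Bool) : (GIdx L n → ℂ) →ₗ[ℂ] (GIdx L n → ℂ) where
  toFun v idx := if keep idx then v idx else 0
  map_add' x y := by funext idx; by_cases h : keep idx <;> simp [h]
  map_smul' c x := by funext idx; by_cases h : keep idx <;> simp [h]

/-- The algebra endomorphism of `E` killing the generators where `keep` is `false`. -/
def evalKill (g : ExteriorAlgebra ℂ (GIdx L n → ℂ) ≃ₐ[ℂ] E) (keep : GIdx L n → Bool) :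
    E →ₐ[ℂ] E :=
  (g.toAlgHom.comp (CliffordAlgebra.map ⟨keepLin L n keep, fun _ => rfl⟩)).comp
    g.symm.toAlgHom

/-- indices other than the `θ` bank. -/
def notθ : GIdx L n → Bool := fun idx =>
  match idx with
  | .inr (.inl _) => false
  | _ => true

/-- indices other than the `ω` bank. -/
def notω : GIdx L n → Bool := fun idx =>
  match idx with
  | .inr (.inr (.inl _)) => false
  | _ => true

/-- indices other than the `ϑ` bank. -/
def notϑ : GIdx L n → Bool := fun idx =>
  match idx with
  | .inr (.inr (.inr _)) => false
  | _ => true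

/-- Berezin extraction of the `θ` top coefficient: `∂_{θ_n}⋯∂_{θ_1}(·)|_{θ=0}`. -/
def Bθ (g : ExteriorAlgebra ℂ (GIdx L n → ℂ) ≃ₐ[ℂ] E) (v : E) : E :=
  evalKill g notθ ((List.finRange n).foldl (fun w k => Dθ g k w) v)

/-- Berezin extraction of the `ω` top coefficient. -/
def Bω (g : ExteriorAlgebra ℂ (GIdx L n → ℂ) ≃ₐ[ℂ] E) (v : E) : E :=
  evalKill g notω ((List.finRange n).foldl (fun w k => Dω g k w) v)

/-- Berezin extraction of the `ϑ` top coefficient. -/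
def Bϑ (g : ExteriorAlgebra ℂ (GIdx L n → ℂ) ≃ₐ[ℂ] E) (v : E) : E :=
  evalKill g notϑ ((List.finRange n).foldl (fun w k => Dϑ g k w) v)

/-- `θ^a`, factors in increasing order. -/
def θpow (g : ExteriorAlgebra ℂ (GIdx L n → ℂ) ≃ₐ[ℂ] E) (a : Fin n → Bool) : E :=
  (List.ofFn fun k => if a k then θg g k else 1).prod

/-- `ω^a`, factors in increasing order. -/
def ωpow (g : ExteriorAlgebra ℂ (GIdx L n → ℂ) ≃ₐ[ℂ] E) (a : Fin n → Bool) : E :=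
  (List.ofFn fun k => if a k then ωg g k else 1).prod

/-- `ϑ^a`, factors in increasing order. -/
def ϑpow (g : ExteriorAlgebra ℂ (GIdx L n → ℂ) ≃ₐ[ℂ] E) (a : Fin n → Bool) : E :=
  (List.ofFn fun k => if a k then ϑg g k else 1).prod

/-- `w^a` for a tuple `w` of (odd) elements of `E`, factors in increasing order. -/
def oddprod (w : Fin n → E) (a : Fin n → Bool) : E :=
  (List.ofFn fun k => if a k then w k else 1).prod

/-- `|a|`: number of `1` entries of a multi-index `a ∈ {0,1}ⁿ`. -/
def mIdxCard {n : ℕ} (a : Fin n → Bool) : ℕ := (Finset.univ.filter fun k => a k).card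

/-- Determinant of a square matrix with entries in `E` (intended for even, hence central,
entries), as the signed sum over permutations of ordered products. -/
def detE {k : ℕ} (M : Matrix (Fin k) (Fin k) E) : E :=
  ∑ σ : Equiv.Perm (Fin k), (Equiv.Perm.sign σ : ℤ) • (List.ofFn fun i => M (σ i) i).prod

/-- Partial derivative `∂/∂q_j` of an `E`-valued function on `ℝ^m`. -/
def pd (j : Fin m) (f : (Fin m → ℝ) → E) : (Fin m → ℝ) → E :=
  fun q => fderiv ℝ f q (Pi.single j 1)

/-- Iterated partial derivatives along a list of directions. -/
def pdIter (l : List (Fin m)) (f : (Fin m → ℝ) → E) : (Fin m → ℝ) → E :=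
  l.foldl (fun h j => pd j h) f

/-- The list of directions attached to a multi-index `α ∈ ℕ^m`. -/
def mlist {m : ℕ} (α : Fin m → ℕ) : List (Fin m) :=
  (List.finRange m).flatMap fun j => List.replicate (α j) j

/-- The (real) body vector of a tuple of even elements. -/
def bodyVec (g : ExteriorAlgebra ℂ (GIdx L n → ℂ) ≃ₐ[ℂ] E) (x : Fin m → E) : Fin m → ℝ :=
  fun j => (πB g (x j)).re

/-- Grassmann continuation `f̃(x) = Σ_α (1/α!) (∂^α f)(π_B x)·x_S^α` of `f : ℝ^m → Λ`,
evaluated at a tuple `x` of even elements with real bodies; the sum is finite since souls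
are nilpotent (order `> L + 3n` terms vanish). -/
def gcont (g : ExteriorAlgebra ℂ (GIdx L n → ℂ) ≃ₐ[ℂ] E)
    (f : (Fin m → ℝ) → E) (x : Fin m → E) : E :=
  ∑ α ∈ Fintype.piFinset (fun _ : Fin m => Finset.range (L + 3 * n + 1)),
    (((∏ j, (α j).factorial : ℕ) : ℂ))⁻¹ •
      (pdIter (mlist α) f (bodyVec g x) * (List.ofFn fun j => soul g (x j) ^ α j).prod)

/-- Evaluation of a supersmooth function, given by its coefficient family
`c : {0,1}ⁿ → C^∞(ℝ^m, Λ)`, at a superpoint `(x, w)` (`x` even with real bodies, `w` odd):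
`Σ_a w^a·(c_a)~(x)`. -/
def seval (g : ExteriorAlgebra ℂ (GIdx L n → ℂ) ≃ₐ[ℂ] E)
    (c : (Fin n → Bool) → (Fin m → ℝ) → E) (x : Fin m → E) (w : Fin n → E) : E :=
  ∑ a : Fin n → Bool, oddprod w a * gcont g (c a) x

section Algebra

omit [CompleteSpace E]

/-- The parity involution of `E`. -/
def parity (g : ExteriorAlgebra ℂ (GIdx L n → ℂ) ≃ₐ[ℂ] E) : E →ₐ[ℂ] E :=
  (g.toAlgHom.comp CliffordAlgebra.involute).comp g.symm.toAlgHom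

/-- The generator of `E` with a given index. -/
def basisGen (g : ExteriorAlgebra ℂ (GIdx L n → ℂ) ≃ₐ[ℂ] E) (i : GIdx L n) : E :=
  gen g (Pi.single i 1)

variable (g : ExteriorAlgebra ℂ (GIdx L n → ℂ) ≃ₐ[ℂ] E)

lemma gen_induction {P : E → Prop} (hC : ∀ r, P (algebraMap ℂ E r))
    (hadd : ∀ x y, P x → P y → P (x + y)) (hmul : ∀ v x, P x → P (gen g v * x)) (x : E) : P x := by
  obtain ⟨x, rfl⟩ := g.surjective x
  induction x using CliffordAlgebra.left_induction with
  | algebraMap r => simpa using hC r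
  | add x y hx hy => simpa using hadd _ _ hx hy
  | ι_mul x v hx => rw [map_mul]; exact hmul v _ hx

lemma gen_eq_sum (v : GIdx L n → ℂ) : gen g v = ∑ i, v i • basisGen g i := by
  simp only [gen, basisGen, ← map_smul, ← map_sum]
  congr 2
  funext i
  simp [Finset.sum_apply, Pi.single_apply]

lemma gen_sub (v w : GIdx L n → ℂ) : gen g (v - w) = gen g v - gen g w := by
  simp [gen]

lemma gen_mul_self (v : GIdx L n → ℂ) : gen g v * gen g v = 0 := by
  rw [gen, ← map_mul, ExteriorAlgebra.ι_sq_zero, map_zero]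

lemma gen_mul_gen (v w : GIdx L n → ℂ) : gen g v * gen g w = -(gen g w * gen g v) := by
  refine eq_neg_of_add_eq_zero_left ?_
  rw [gen, gen, ← map_mul g, ← map_mul g, ← map_add, ExteriorAlgebra.ι_add_mul_swap, map_zero]

@[simp] lemma parity_gen (v : GIdx L n → ℂ) : parity g (gen g v) = -gen g v := by
  simp [parity, gen, ExteriorAlgebra.ι]

@[simp] lemma parity_basisGen (i : GIdx L n) : parity g (basisGen g i) = -basisGen g i :=
  parity_gen g _

@[simp] lemma parity_parity (x : E) : parity g (parity g x) = x := by
  simp [parity]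

lemma mul_gen (v : GIdx L n → ℂ) (x : E) : x * gen g v = gen g v * parity g x := by
  induction x using gen_induction g with
  | hC r => simp [Algebra.commutes]
  | hadd x y hx hy => simp [add_mul, mul_add, hx, hy]
  | hmul w x hx =>
    rw [mul_assoc, hx, ← mul_assoc, gen_mul_gen, map_mul, parity_gen]
    noncomm_ring

lemma parity_eq_self_of_mem_evenPart {x : E} (hx : x ∈ evenPart g) : parity g x = x := by
  obtain ⟨x, hx, rfl⟩ := hx
  simp [parity, CliffordAlgebra.involute_eq_of_mem_even hx]

lemma parity_eq_neg_of_mem_oddPart {x : E} (hx : x ∈ oddPart g) : parity g x = -x := by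
  obtain ⟨x, hx, rfl⟩ := hx
  simp [parity, CliffordAlgebra.involute_eq_of_mem_odd hx]

lemma mem_evenPart_iff {x : E} : x ∈ evenPart g ↔ parity g x = x := by
  refine ⟨parity_eq_self_of_mem_evenPart g, fun h => ?_⟩
  obtain ⟨a, ha, b, hb, hab⟩ := Submodule.mem_sup.mp
    ((CliffordAlgebra.evenOdd_isCompl (0 : QuadraticForm ℂ (GIdx L n → ℂ))).sup_eq_top ▸
      Submodule.mem_top (x := g.symm x))
  have hga : g a ∈ evenPart g := ⟨a, ha, rfl⟩
  have hgb : g b ∈ oddPart g := ⟨b, hb, rfl⟩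
  have hx : x = g a + g b := by rw [← map_add, hab, g.apply_symm_apply]
  have hb0 : g b = 0 := by
    rw [hx, map_add, parity_eq_self_of_mem_evenPart g hga, parity_eq_neg_of_mem_oddPart g hgb,
      add_right_inj, neg_eq_iff_add_eq_zero, ← two_smul ℂ] at h
    exact (smul_eq_zero.mp h).resolve_left two_ne_zero
  rw [hx, hb0, add_zero]
  exact hga

lemma Dop_gen_mul (i : GIdx L n) (v : GIdx L n → ℂ) (x : E) :
    Dop g i (gen g v * x) = v i • x - gen g v * Dop g i x := by
  have h := CliffordAlgebra.contractLeft_ι_mul (Q := (0 : QuadraticForm ℂ (GIdx L n → ℂ)))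
    (d := LinearMap.proj i) v (g.symm x)
  have h' := congrArg g h
  simpa [Dop, gen, ExteriorAlgebra.ι] using h'

lemma Dop_algebraMap (i : GIdx L n) (r : ℂ) : Dop g i (algebraMap ℂ E r) = 0 := by
  have h := CliffordAlgebra.contractLeft_algebraMap (Q := (0 : QuadraticForm ℂ (GIdx L n → ℂ)))
    (d := LinearMap.proj i) r
  simp [Dop, h]

@[simp] lemma Dop_one (i : GIdx L n) : Dop g i 1 = 0 := by
  simpa using Dop_algebraMap g i 1

lemma Dop_basisGen (i j : GIdx L n) :
    Dop g i (basisGen g j) = if i = j then 1 else 0 := by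
  have h := Dop_gen_mul g i (Pi.single j 1) 1
  rw [mul_one, Dop_one, mul_zero, sub_zero] at h
  rw [basisGen, h, Pi.single_apply]
  split_ifs <;> simp

lemma Dop_mul (i : GIdx L n) (x y : E) :
    Dop g i (x * y) = Dop g i x * y + parity g x * Dop g i y := by
  induction x using gen_induction g with
  | hC r => simp [Dop_algebraMap, ← Algebra.smul_def]
  | hadd x z hx hz => simp only [add_mul, map_add, hx, hz]; abel
  | hmul v x hx =>
    rw [mul_assoc, Dop_gen_mul, hx, Dop_gen_mul, map_mul, parity_gen, sub_mul, smul_mul_assoc, mul_add]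
    noncomm_ring

lemma Dop_comm (i j : GIdx L n) (x : E) : Dop g i (Dop g j x) = -Dop g j (Dop g i x) := by
  have h := CliffordAlgebra.contractLeft_comm (Q := (0 : QuadraticForm ℂ (GIdx L n → ℂ)))
    (d := LinearMap.proj i) (d' := LinearMap.proj j) (g.symm x)
  have h' := congrArg g h
  simpa [Dop] using h'

lemma Dop_Dop (i : GIdx L n) (x : E) : Dop g i (Dop g i x) = 0 := by
  have h := CliffordAlgebra.contractLeft_contractLeft
    (Q := (0 : QuadraticForm ℂ (GIdx L n → ℂ))) (d := LinearMap.proj i) (g.symm x)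
  have h' := congrArg g h
  simpa [Dop] using h'

lemma parity_Dop (i : GIdx L n) (x : E) : parity g (Dop g i x) = -Dop g i (parity g x) := by
  induction x using gen_induction g with
  | hC r => simp [Dop_algebraMap]
  | hadd x y hx hy => simp only [map_add, hx, hy]; abel
  | hmul v x hx =>
    rw [Dop_gen_mul, map_sub, map_smul, map_mul, hx, map_mul, parity_gen, neg_mul, neg_mul,
      map_neg, Dop_gen_mul]
    noncomm_ring

lemma evalKill_gen (keep : GIdx L n → Bool) (v : GIdx L n → ℂ) :
    evalKill g keep (gen g v) = gen g (keepLin L n keep v) := by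
  simp only [evalKill, gen, ExteriorAlgebra.ι, AlgHom.comp_apply]
  erw [g.symm_apply_apply, CliffordAlgebra.map_apply_ι]
  rfl

lemma evalKill_basisGen (keep : GIdx L n → Bool) (i : GIdx L n) :
    evalKill g keep (basisGen g i) = if keep i then basisGen g i else 0 := by
  rw [basisGen, evalKill_gen]
  have : keepLin L n keep (Pi.single i 1) = if keep i then Pi.single i 1 else 0 := by
    funext j
    by_cases hj : j = i
    · subst hj; by_cases h : keep j <;> simp [keepLin, h]
    · by_cases h : keep i <;> simp [keepLin, h, hj]
  rw [this]
  split_ifs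
  · rfl
  · simp [gen]

lemma parity_evalKill (keep : GIdx L n → Bool) (x : E) :
    parity g (evalKill g keep x) = evalKill g keep (parity g x) := by
  induction x using gen_induction g with
  | hC r => simp
  | hadd x y hx hy => simp [hx, hy]
  | hmul v x hx => simp [evalKill_gen, hx]

/-- The subalgebra of even elements of `E`. -/
def evenSub : Subalgebra ℂ E := AlgHom.equalizer (parity g) (AlgHom.id ℂ E)

variable {g} in
lemma mem_evenSub_iff {x : E} : x ∈ evenSub g ↔ parity g x = x := Iff.rfl

variable {g} in
lemma evenSub_commute {x : E} (hx : x ∈ evenSub g) (y : E) : x * y = y * x := by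
  induction y using gen_induction g with
  | hC r => exact (Algebra.commutes r x).symm
  | hadd y z hy hz => rw [mul_add, add_mul, hy, hz]
  | hmul v y hy => rw [← mul_assoc, mul_gen, hx, AlgHom.id_apply, mul_assoc, hy, mul_assoc]

instance : CommRing (evenSub g) :=
  { (inferInstance : Ring (evenSub g)) with
    mul_comm := fun x y => Subtype.ext (evenSub_commute x.2 y) }

instance evenSubAlgebra : Algebra (evenSub g) E where
  algebraMap := (evenSub g).val.toRingHom
  commutes' x y := evenSub_commute x.2 y
  smul_def' _ _ := rfl

/-- The left odd derivative, as a derivation on even elements. -/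
def evenDerivation (i : GIdx L n) : Derivation ℂ (evenSub g) E :=
  Derivation.mk' (Dop g i ∘ₗ (evenSub g).val.toLinearMap) fun x y => by
    change Dop g i (x * y : E) = (x : E) * Dop g i y + (y : E) * Dop g i x
    rw [Dop_mul, mem_evenSub_iff.mp x.2, evenSub_commute y.2, add_comm]

/-- The evaluation killing generators, restricted to even elements. -/
def evenKill (keep : GIdx L n → Bool) : evenSub g →ₐ[ℂ] evenSub g :=
  ((evalKill g keep).comp (evenSub g).val).codRestrict (evenSub g) fun x => by
    rw [mem_evenSub_iff, AlgHom.comp_apply, parity_evalKill, Subalgebra.coe_val,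
      mem_evenSub_iff.mp x.2]

end Algebra

section Determinant

variable {k R V ι : Type*} [CommRing k] [CommRing R] [Algebra k R] [AddCommGroup V] [Module k V]
  [Module R V] [Fintype ι] [DecidableEq ι]

omit [Fintype ι] in
lemma derivation_prod (D : Derivation k R V) (s : Finset ι) (f : ι → R) :
    D (∏ i ∈ s, f i) = ∑ i ∈ s, (∏ j ∈ s.erase i, f j) • D (f i) := by
  induction s using Finset.induction_on with
  | empty => simp
  | insert a s ha ih =>
    rw [Finset.prod_insert ha, D.leibniz, ih, Finset.sum_insert ha, Finset.erase_insert ha,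
      add_comm, Finset.smul_sum]
    refine congrArg _ (Finset.sum_congr rfl fun i hi => ?_)
    have hia : a ≠ i := fun h => ha (h ▸ hi)
    rw [Finset.erase_insert_of_ne hia, Finset.prod_insert (by simp [ha]), mul_smul]

lemma adjugate_eq_sum_perm (M : Matrix ι ι R) (i j : ι) :
    M.adjugate j i = ∑ σ : Equiv.Perm ι,
      if σ j = i then (Equiv.Perm.sign σ : ℤ) • ∏ l ∈ Finset.univ.erase j, M (σ l) l else 0 := by
  rw [Matrix.adjugate_apply, Matrix.det_apply]
  refine Finset.sum_congr rfl fun σ _ => ?_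
  split_ifs with h
  · rw [← Finset.mul_prod_erase _ _ (Finset.mem_univ j), h, Matrix.updateRow_self,
      Pi.single_eq_same, one_mul]
    refine congrArg _ (Finset.prod_congr rfl fun l hl => ?_)
    rw [Matrix.updateRow_ne fun hl' => Finset.ne_of_mem_erase hl (σ.injective (hl'.trans h.symm))]
  · rw [Finset.prod_eq_zero (Finset.mem_univ (σ.symm i)), smul_zero]
    rw [σ.apply_symm_apply, Matrix.updateRow_self,
      Pi.single_eq_of_ne fun h' => h (by rw [← h', σ.apply_symm_apply])]

/-- Jacobi's formula for a module-valued derivation. -/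
lemma derivation_det (D : Derivation k R V) (M : Matrix ι ι R) :
    D M.det = ∑ i, ∑ j, M.adjugate j i • D (M i j) := by
  have h (σ : Equiv.Perm ι) : D (Equiv.Perm.sign σ • ∏ l, M (σ l) l) =
      ∑ j, ∑ i, (if σ j = i then
        (Equiv.Perm.sign σ : ℤ) • ∏ l ∈ Finset.univ.erase j, M (σ l) l else 0) • D (M i j) := by
    rw [Units.smul_def, map_zsmul, derivation_prod, Finset.smul_sum]
    refine Finset.sum_congr rfl fun j _ => ?_
    simp [ite_smul, mul_smul, Int.cast_smul_eq_zsmul]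
  rw [Matrix.det_apply, map_sum, Finset.sum_congr rfl fun σ _ => h σ, Finset.sum_comm]
  refine Eq.trans ?_ Finset.sum_comm
  refine Finset.sum_congr rfl fun j _ => ?_
  rw [Finset.sum_comm]
  exact Finset.sum_congr rfl fun i _ => by rw [adjugate_eq_sum_perm, Finset.sum_smul]

/-- The Piola identity for odd Jacobians: if `D i (M j l) = -D j (M i l)`, the columns of
`(det M)⁻¹ • M⁻¹` are divergence-free. -/
lemma piola_identity (D : ι → Derivation k R V) {M N : Matrix ι ι R} (hMN : M * N = 1)
    (hD : ∀ i j l, D i (M j l) = -D j (M i l)) {d : R} (hd : M.det * d = 1) (l : ι) :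
    ∑ j, D j (d * N l j) = 0 := by
  have hNM : N * M = 1 := mul_eq_one_comm.mp hMN
  have hadj : M.adjugate = M.det • N := by
    rw [← mul_one M.adjugate, ← hMN, ← mul_assoc, Matrix.adjugate_mul, smul_mul_assoc, one_mul]
  have hDd (j : ι) : D j d = -∑ a, ∑ b, (d * N b a) • D j (M a b) := by
    have h : D j (M.det * d) = 0 := by rw [hd, Derivation.map_one_eq_zero]
    rw [(D j).leibniz, derivation_det, hadj] at h
    have h' := congrArg (d • ·) h
    simp only [smul_add, smul_smul, mul_comm d M.det, hd, one_smul, smul_zero,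
      Finset.smul_sum, Matrix.smul_apply, smul_eq_mul] at h'
    rw [eq_neg_of_add_eq_zero_left h']
    congr 1
    refine Finset.sum_congr rfl fun a _ => Finset.sum_congr rfl fun b _ => ?_
    congr 1
    linear_combination (d * N b a) * hd
  have hDN (j a : ι) : D j (N l a) = -∑ p, ∑ q, (N l p * N q a) • D j (M p q) := by
    have h (q : ι) : ∑ p, (N l p • D j (M p q) + M p q • D j (N l p)) = 0 := by
      have := congrArg (D j) (congrFun (congrFun hNM l) q)
      rw [Matrix.mul_apply, map_sum] at this
      simp_rw [Derivation.leibniz] at this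
      rw [this, Matrix.one_apply]
      split_ifs <;> simp
    have h2 : ∑ q, N q a • ∑ p, (N l p • D j (M p q) + M p q • D j (N l p)) = 0 := by
      simp [h]
    simp_rw [Finset.sum_add_distrib, smul_add, Finset.sum_add_distrib, Finset.smul_sum,
      smul_smul] at h2
    have h3 : ∑ q, ∑ p, (N q a * M p q) • D j (N l p) = D j (N l a) := by
      rw [Finset.sum_comm]
      simp_rw [← Finset.sum_smul, mul_comm (N _ a), ← Matrix.mul_apply, hMN, Matrix.one_apply,
        ite_smul, one_smul, zero_smul]
      simp
    rw [h3] at h2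
    rw [eq_neg_of_add_eq_zero_right h2, Finset.sum_comm]
    simp_rw [mul_comm]
  simp_rw [Derivation.leibniz, hDd, hDN]
  simp_rw [smul_neg, Finset.smul_sum, smul_smul, Finset.sum_add_distrib, Finset.sum_neg_distrib]
  rw [← neg_add, neg_eq_zero]
  have key : ∑ j, ∑ a, ∑ b, (N l j * (d * N b a)) • D j (M a b) =
      -∑ j, ∑ a, ∑ b, (d * (N l a * N b j)) • D j (M a b) := by
    rw [Finset.sum_comm, ← Finset.sum_neg_distrib]
    refine Finset.sum_congr rfl fun a _ => ?_
    rw [← Finset.sum_neg_distrib]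
    refine Finset.sum_congr rfl fun j _ => ?_
    rw [← Finset.sum_neg_distrib]
    refine Finset.sum_congr rfl fun b _ => ?_
    rw [hD j a b, smul_neg]
    congr 2
    ring
  rw [key, add_neg_cancel]

end Determinant

section Berezin

omit [CompleteSpace E]

variable (g : ExteriorAlgebra ℂ (GIdx L n → ℂ) ≃ₐ[ℂ] E)

/-- Elements of a given parity in the kernel of `evalKill` are combinations of the killed
generators, with coefficients of the opposite parity. -/
lemma exists_sub_evalKill_eq_sum (keep : GIdx L n → Bool) {s : ℂ} (hs : s * s = 1) {x : E}
    (hx : parity g x = s • x) : ∃ h : GIdx L n → E, (∀ i, parity g (h i) = -(s • h i)) ∧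
      x - evalKill g keep x = ∑ i, if keep i then 0 else basisGen g i * h i := by
  have aux (y : E) : ∃ h : GIdx L n → E,
      y - evalKill g keep y = ∑ i, if keep i then 0 else basisGen g i * h i := by
    induction y using gen_induction g with
    | hC r => exact ⟨0, by simp⟩
    | hadd y z hy hz =>
      obtain ⟨h, hh⟩ := hy
      obtain ⟨h', hh'⟩ := hz
      refine ⟨h + h', ?_⟩
      rw [map_add, add_sub_add_comm, hh, hh', ← Finset.sum_add_distrib]
      refine Finset.sum_congr rfl fun i _ => ?_
      split_ifs <;> simp [mul_add]
    | hmul v y hy =>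
      obtain ⟨h, hh⟩ := hy
      refine ⟨fun i => v i • y - gen g (keepLin L n keep v) * h i, ?_⟩
      rw [map_mul, evalKill_gen]
      have h1 : gen g v * y - gen g (keepLin L n keep v) * evalKill g keep y =
          (gen g v - gen g (keepLin L n keep v)) * y
            + gen g (keepLin L n keep v) * (y - evalKill g keep y) := by noncomm_ring
      rw [h1, hh, ← gen_sub, gen_eq_sum, Finset.sum_mul, Finset.mul_sum,
        ← Finset.sum_add_distrib]
      refine Finset.sum_congr rfl fun i _ => ?_
      by_cases hi : keep i
      · simp [keepLin, hi]
      · simp only [keepLin, LinearMap.coe_mk, AddHom.coe_mk, Pi.sub_apply, hi, if_false,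
          sub_zero, Bool.false_eq_true, mul_sub, smul_mul_assoc, mul_smul_comm]
        rw [← mul_assoc, ← mul_assoc, basisGen, gen_mul_gen, neg_mul, ← sub_eq_add_neg]
  obtain ⟨h, hh⟩ := aux x
  refine ⟨fun i => (2⁻¹ : ℂ) • (h i - s • parity g (h i)), fun i => ?_, ?_⟩
  · simp only [map_smul, map_sub, parity_parity]
    rw [smul_comm s (2⁻¹ : ℂ), ← smul_neg, smul_sub s, smul_smul s s, hs, one_smul, neg_sub]
  · have hp : x - evalKill g keep x =
        -(s • ∑ i, if keep i then 0 else basisGen g i * parity g (h i)) := by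
      have h1 : parity g (x - evalKill g keep x) = s • (x - evalKill g keep x) := by
        rw [map_sub, parity_evalKill, hx, map_smul, smul_sub]
      have h2 : x - evalKill g keep x = s • parity g (x - evalKill g keep x) := by
        rw [h1, smul_smul, hs, one_smul]
      rw [h2, hh, map_sum, ← smul_neg, ← Finset.sum_neg_distrib]
      congr 1
      refine Finset.sum_congr rfl fun i _ => ?_
      split_ifs <;> simp
    have h3 : x - evalKill g keep x =
        (2⁻¹ : ℂ) • ((x - evalKill g keep x) + (x - evalKill g keep x)) := by
      rw [← two_smul ℂ, smul_smul]; norm_num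
    rw [h3]
    nth_rw 1 [hh]
    rw [hp, ← sub_eq_add_neg, Finset.smul_sum,
      ← Finset.sum_sub_distrib, Finset.smul_sum]
    refine Finset.sum_congr rfl fun i _ => ?_
    split_ifs <;> simp [mul_sub]

lemma isNilpotent_sub_evenKill (keep : GIdx L n → Bool) (x : evenSub g) :
    IsNilpotent (x - evenKill g keep x) := by
  obtain ⟨h, hpar, hsum⟩ := exists_sub_evalKill_eq_sum g keep (one_mul 1) (x := x)
    (by rw [one_smul]; exact x.2)
  have hmem (i : GIdx L n) : basisGen g i * h i ∈ evenSub g := by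
    rw [mem_evenSub_iff, map_mul, hpar, parity_basisGen, one_smul, neg_mul_neg]
  have hx : x - evenKill g keep x =
      ∑ i, if keep i then 0 else (⟨basisGen g i * h i, hmem i⟩ : evenSub g) := by
    refine Subtype.ext (Eq.trans hsum ?_)
    rw [AddSubmonoidClass.coe_finsetSum]
    refine Finset.sum_congr rfl fun i _ => ?_
    split_ifs <;> rfl
  rw [hx]
  refine isNilpotent_sum fun i _ => ?_
  split_ifs
  · exact IsNilpotent.zero
  · refine ⟨2, Subtype.ext ?_⟩
    change (basisGen g i * h i) ^ 2 = 0
    rw [sq, mul_assoc, ← mul_assoc (h i), basisGen, mul_gen, ← mul_assoc, ← mul_assoc,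
      gen_mul_self, zero_mul, zero_mul]

lemma isUnit_of_isUnit_evenKill (keep : GIdx L n → Bool) {x : evenSub g}
    (hx : IsUnit (evenKill g keep x)) : IsUnit x := by
  rw [← add_sub_cancel (evenKill g keep x) x]
  exact (isNilpotent_sub_evenKill g keep x).isUnit_add_left_of_commute hx (Commute.all _ _)

lemma detE_coe {k : ℕ} (M : Matrix (Fin k) (Fin k) (evenSub g)) :
    detE (fun i j => (M i j : E)) = (M.det : E) := by
  unfold detE
  rw [Matrix.det_apply, AddSubmonoidClass.coe_finsetSum]
  refine Finset.sum_congr rfl fun σ _ => ?_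
  rw [← List.prod_ofFn, Units.smul_def, AddSubgroupClass.coe_zsmul]
  congr 1
  rw [← Subalgebra.coe_val, map_list_prod, List.map_ofFn]
  rfl

variable (J : Fin n → GIdx L n)

/-- The iterated left derivative along a list of generators. -/
def iterDop (l : List (Fin n)) (v : E) : E := l.foldl (fun w k => Dop g (J k) w) v

@[simp] lemma iterDop_nil (v : E) : iterDop g J [] v = v := rfl

@[simp] lemma iterDop_cons (k : Fin n) (l : List (Fin n)) (v : E) :
    iterDop g J (k :: l) v = iterDop g J l (Dop g (J k) v) := rfl

lemma iterDop_add (l : List (Fin n)) (v w : E) :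
    iterDop g J l (v + w) = iterDop g J l v + iterDop g J l w := by
  induction l generalizing v w with
  | nil => rfl
  | cons k l ih => simp [ih]

lemma iterDop_zero (l : List (Fin n)) : iterDop g J l 0 = 0 := by
  induction l with
  | nil => rfl
  | cons k l ih => simp [ih]

lemma iterDop_neg (l : List (Fin n)) (v : E) : iterDop g J l (-v) = -iterDop g J l v := by
  refine eq_neg_of_add_eq_zero_left ?_
  rw [← iterDop_add, neg_add_cancel, iterDop_zero]

lemma iterDop_sum {ι : Type*} (l : List (Fin n)) (s : Finset ι) (f : ι → E) :
    iterDop g J l (∑ i ∈ s, f i) = ∑ i ∈ s, iterDop g J l (f i) :=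
  map_sum (AddMonoidHom.mk' (iterDop g J l) (iterDop_add g J l)) f s

/-- The Berezin integral of an odd derivative vanishes. -/
lemma iterDop_Dop {l : List (Fin n)} {j : Fin n} (hj : j ∈ l) (v : E) :
    iterDop g J l (Dop g (J j) v) = 0 := by
  induction l generalizing v with
  | nil => simp at hj
  | cons k l ih =>
    rw [iterDop_cons]
    rcases List.mem_cons.mp hj with rfl | hj
    · rw [Dop_Dop, iterDop_zero]
    · rw [Dop_comm, iterDop_neg, ih hj, neg_zero]

variable {J} (hJ : Function.Injective J) {keep : GIdx L n → Bool} (hk : ∀ k, keep (J k) = false)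

include hk in
lemma evalKill_iterDop_basisGen_mul {l : List (Fin n)} {j : Fin n} (hj : J j ∉ l.map J) (v : E) :
    evalKill g keep (iterDop g J l (basisGen g (J j) * v)) = 0 := by
  induction l generalizing v with
  | nil => simp [evalKill_basisGen, hk]
  | cons k l ih =>
    rw [List.map_cons, List.mem_cons, not_or] at hj
    rw [iterDop_cons, Dop_mul, Dop_basisGen, if_neg (Ne.symm hj.1), zero_mul, zero_add,
      parity_basisGen, ← mul_neg_one, mul_assoc, ih hj.2]

include hJ hk in
lemma evalKill_iterDop_prod_mul {l : List (Fin n)} (hl : l.Nodup) (x : E) :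
    evalKill g keep (iterDop g J l ((l.map fun k => basisGen g (J k)).prod * x)) =
      evalKill g keep x := by
  induction l with
  | nil => simp
  | cons k l ih =>
    rw [List.nodup_cons] at hl
    rw [List.map_cons, List.prod_cons, iterDop_cons, mul_assoc, Dop_mul, Dop_basisGen, if_pos rfl,
      one_mul, parity_basisGen, ← mul_neg_one (basisGen g (J k)), mul_assoc, iterDop_add, map_add,
      ih hl.2, evalKill_iterDop_basisGen_mul g hk (by simpa [hJ.eq_iff] using hl.1), add_zero]

/-- A graded derivation kills a product of elements it kills. -/
lemma gradedDerivation_list_prod {D : E →ₗ[ℂ] E}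
    (hD : ∀ x y, D (x * y) = D x * y + parity g x * D y) (hD1 : D 1 = 0) {l : List E}
    (hl : ∀ x ∈ l, D x = 0) : D l.prod = 0 := by
  induction l with
  | nil => simpa using hD1
  | cons x l ih =>
    rw [List.prod_cons, hD, hl x (by simp), ih fun y hy => hl y (List.mem_cons_of_mem _ hy)]
    simp

lemma gradedDerivation_oddprod {D : E →ₗ[ℂ] E}
    (hD : ∀ x y, D (x * y) = D x * y + parity g x * D y) (hD1 : D 1 = 0) {w : Fin n → E}
    {a : Fin n → Bool} (hw : ∀ k, a k = true → D (w k) = 0) : D (oddprod w a) = 0 := by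
  refine gradedDerivation_list_prod g hD hD1 fun x hx => ?_
  obtain ⟨k, rfl⟩ := (List.mem_ofFn' _ _).mp hx
  change D (if a k then w k else 1) = 0
  split_ifs with h
  · exact hw k h
  · exact hD1

omit [NormedAlgebra ℂ E] in
lemma oddprod_true (w : Fin n → E) :
    oddprod w (fun _ => true) = ((List.finRange n).map w).prod := by
  simp [oddprod, List.ofFn_eq_map]

lemma Dop_eq_zero_of_mem_ΛSub {f : E} (hf : f ∈ ΛSub g) (i : Fin n ⊕ (Fin n ⊕ Fin n)) :
    Dop g (Sum.inr i) f = 0 := by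
  induction hf using Algebra.adjoin_induction with
  | mem x hx =>
    obtain ⟨k, rfl⟩ := hx
    exact (Dop_basisGen g _ _).trans (if_neg (by simp))
  | algebraMap r => exact Dop_algebraMap g _ r
  | add x y _ _ hx hy => rw [map_add, hx, hy, add_zero]
  | mul x y _ _ hx hy => rw [Dop_mul, hx, hy, zero_mul, mul_zero, add_zero]

lemma evalKill_eq_self_of_mem_ΛSub {f : E} (hf : f ∈ ΛSub g)
    (hkeep : ∀ i, keep (Sum.inl i) = true) : evalKill g keep f = f := by
  induction hf using Algebra.adjoin_induction with
  | mem x hx =>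
    obtain ⟨k, rfl⟩ := hx
    exact (evalKill_basisGen g _ _).trans (if_pos (hkeep k))
  | algebraMap r => simp
  | add x y _ _ hx hy => rw [map_add, hx, hy]
  | mul x y _ _ hx hy => rw [map_mul, hx, hy]

/-- The Berezin integral over `θ` extracts the top coefficient. -/
lemma Bθ_sum_θpow_mul {f : (Fin n → Bool) → E} (hf : ∀ a, f a ∈ ΛSub g) :
    Bθ g (∑ a, θpow g a * f a) = f fun _ => true := by
  set J : Fin n → GIdx L n := fun k => Sum.inr (Sum.inl k)
  have hJ : Function.Injective J := fun i j h => by simpa [J] using h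
  have hB (v : E) : Bθ g v = evalKill g notθ (iterDop g J (List.finRange n) v) := rfl
  rw [hB, iterDop_sum, map_sum, Finset.sum_eq_single fun _ => true]
  · have h1 : θpow g (fun _ => true) = ((List.finRange n).map fun k => basisGen g (J k)).prod :=
      oddprod_true (fun k => basisGen g (J k))
    rw [h1, evalKill_iterDop_prod_mul g hJ (fun _ => rfl) (List.nodup_finRange n),
      evalKill_eq_self_of_mem_ΛSub g (hf _) fun _ => rfl]
  · intro a _ ha
    obtain ⟨k, hk⟩ : ∃ k, a k = false := by
      by_contra! h
      exact ha (funext fun k => by simpa using h k)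
    have h0 : Dop g (J k) (θpow g a * f a) = 0 := by
      have : Dop g (J k) (θpow g a) = 0 :=
        gradedDerivation_oddprod g (Dop_mul g (J k)) (Dop_one g _) fun l hl => by
          refine (Dop_basisGen g _ _).trans (if_neg fun h => ?_)
          simp [← hJ h, hk] at hl
      rw [Dop_mul, this, Dop_eq_zero_of_mem_ΛSub g (hf a), zero_mul, mul_zero, add_zero]
    have h1 : θpow g a * f a = Dop g (J k) (basisGen g (J k) * (θpow g a * f a)) := by
      rw [Dop_mul, h0, Dop_basisGen, if_pos rfl, one_mul, mul_zero, add_zero]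
    rw [h1, iterDop_Dop g J (List.mem_finRange k), map_zero]
  · simp

end Berezin

section OddChange

omit [CompleteSpace E]

variable {g : ExteriorAlgebra ℂ (GIdx L n → ℂ) ≃ₐ[ℂ] E}

lemma odd_mul {x : E} (hx : parity g x = -x) (y : E) : x * y = parity g y * x := by
  induction y using gen_induction g with
  | hC r => simp [Algebra.commutes]
  | hadd y z hy hz => rw [mul_add, map_add, add_mul, hy, hz]
  | hmul v y hy =>
    rw [← mul_assoc, mul_gen, hx, map_mul, parity_gen, mul_neg, neg_mul, mul_assoc, hy]
    noncomm_ring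

lemma odd_mul_self {x : E} (hx : parity g x = -x) : x * x = 0 := by
  have h := odd_mul hx x
  rw [hx, neg_mul, eq_neg_iff_add_eq_zero, ← two_smul ℂ] at h
  exact (smul_eq_zero.mp h).resolve_left two_ne_zero

/-- A product of `n` even combinations of `n` odd elements is a determinant times their product. -/
lemma prod_sum_smul_odd {w : Fin n → E} (hw : ∀ k, parity g (w k) = -w k)
    (h : Matrix (Fin n) (Fin n) (evenSub g)) :
    oddprod (fun k => ∑ j, h j k • w j) (fun _ => true) =
      h.det • oddprod w (fun _ => true) := by
  have hpar (v : Fin n → evenSub g) : parity g (Fintype.linearCombination (evenSub g) w v) =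
      -Fintype.linearCombination (evenSub g) w v := by
    rw [Fintype.linearCombination_apply, map_sum, ← Finset.sum_neg_distrib]
    refine Finset.sum_congr rfl fun j _ => ?_
    change parity g ((v j : E) * w j) = -((v j : E) * w j)
    rw [map_mul, mem_evenSub_iff.mp (v j).2, hw, mul_neg]
  obtain ⟨A, hA⟩ : ∃ A : (Fin n → evenSub g) [⋀^Fin n]→ₗ[evenSub g] E,
      ∀ v, A v = oddprod (fun k => ∑ j, v k j • w j) (fun _ => true) := by
    refine ⟨(ExteriorAlgebra.lift (evenSub g) ⟨Fintype.linearCombination (evenSub g) w,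
      fun v => odd_mul_self (hpar v)⟩).toLinearMap.compAlternatingMap
        (ExteriorAlgebra.ιMulti (evenSub g) n), fun v => ?_⟩
    simp only [LinearMap.compAlternatingMap_apply, ExteriorAlgebra.ιMulti_apply,
      AlgHom.toLinearMap_apply, map_list_prod, List.map_ofFn, oddprod, if_true]
    congr 2
    funext k
    simp [Fintype.linearCombination_apply]
  have hAdet : A = (LinearMap.toSpanSingleton (evenSub g) E
      (oddprod w fun _ => true)).compAlternatingMap Matrix.detRowAlternating := by
    refine Module.Basis.ext_alternating (Pi.basisFun (evenSub g) (Fin n)) fun v hv => ?_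
    obtain ⟨σ, rfl⟩ : ∃ σ : Equiv.Perm (Fin n), v = σ :=
      ⟨Equiv.ofBijective v (Finite.injective_iff_bijective.mp hv), rfl⟩
    have hbasis : A (fun i => Pi.basisFun (evenSub g) (Fin n) i) = oddprod w fun _ => true := by
      rw [hA]
      congr 1
      funext k
      simp [Pi.single_apply]
    have hdet : Matrix.detRowAlternating (fun i => Pi.basisFun (evenSub g) (Fin n) i) = 1 := by
      rw [← Pi.basisFun_det]
      exact Module.Basis.det_self _
    have h1 := A.map_perm (fun i => Pi.basisFun (evenSub g) (Fin n) i) σ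
    have h2 := (Matrix.detRowAlternating (R := evenSub g)).map_perm
      (fun i => Pi.basisFun (evenSub g) (Fin n) i) σ
    simp only [Function.comp_def] at h1 h2
    rw [h1, LinearMap.compAlternatingMap_apply, h2, hbasis, hdet, map_zsmul_unit,
      LinearMap.toSpanSingleton_apply, one_smul]
  rw [← hA (fun k j => h j k), hAdet, LinearMap.compAlternatingMap_apply, LinearMap.toSpanSingleton_apply]
  exact congrArg (· • oddprod w fun _ => true) (Matrix.det_transpose h)

variable {φ : Fin n → E}

/-- The odd Jacobian matrix `(∂_{ω_j} φ_k)` of a tuple of odd elements. -/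
def oddJacobian (hφ : ∀ k, parity g (φ k) = -φ k) : Matrix (Fin n) (Fin n) (evenSub g) :=
  Matrix.of fun j k => ⟨Dω g j (φ k), by
    rw [mem_evenSub_iff, Dω, parity_Dop, hφ, map_neg, neg_neg]⟩

lemma exists_eq_sum_ωg (hφ : ∀ k, parity g (φ k) = -φ k) (hφ0 : ∀ k, evalKill g notω (φ k) = 0) :
    ∃ h : Matrix (Fin n) (Fin n) (evenSub g), ∀ k, φ k = ∑ j, h j k • ωg g j := by
  have (k : Fin n) := exists_sub_evalKill_eq_sum g notω (s := -1) (by norm_num) (x := φ k)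
    (by rw [hφ, neg_one_smul])
  choose h hpar hsum using this
  have hmem (j k : Fin n) : h k (Sum.inr (Sum.inr (Sum.inl j))) ∈ evenSub g := by
    rw [mem_evenSub_iff, hpar, neg_one_smul, neg_neg]
  refine ⟨Matrix.of fun j k => ⟨_, hmem j k⟩, fun k => ?_⟩
  have hk := hsum k
  rw [hφ0, sub_zero] at hk
  rw [hk]
  simp only [Fintype.sum_sum_type, notω, if_true, Finset.sum_const_zero, zero_add, add_zero,
    Bool.false_eq_true, if_false]
  exact Finset.sum_congr rfl fun j _ => (evenSub_commute (hmem j k) _).symm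

lemma Bω_sum {ι : Type*} (s : Finset ι) (f : ι → E) :
    Bω g (∑ i ∈ s, f i) = ∑ i ∈ s, Bω g (f i) := by
  change evalKill g notω (iterDop g (fun k => Sum.inr (Sum.inr (Sum.inl k))) _ _) = _
  rw [iterDop_sum, map_sum]
  rfl

lemma Bω_Dω (j : Fin n) (v : E) : Bω g (Dω g j v) = 0 := by
  change evalKill g notω (iterDop g (fun k => Sum.inr (Sum.inr (Sum.inl k))) _ _) = _
  refine (congrArg _ (iterDop_Dop g _ (List.mem_finRange j) v)).trans (map_zero _)

lemma Bω_ωpow_mul (x : E) : Bω g (oddprod (ωg g) (fun _ => true) * x) = evalKill g notω x := by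
  rw [oddprod_true]
  exact evalKill_iterDop_prod_mul g (J := fun k => Sum.inr (Sum.inr (Sum.inl k)))
    (fun i j h => by simpa using h) (fun _ => rfl) (List.nodup_finRange n) x

lemma Dω_ωg (i j : Fin n) : Dω g i (ωg g j) = if i = j then 1 else 0 := by
  refine (Dop_basisGen g _ _).trans ?_
  simp

lemma evalKill_Dω_smul_ωg (i j : Fin n) (x : evenSub g) :
    evalKill g notω (Dω g i (x • ωg g j)) = if i = j then evalKill g notω (x : E) else 0 := by
  have hω : evalKill g notω (ωg g j) = 0 := evalKill_basisGen g _ _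
  have hx : x • ωg g j = ωg g j * (x : E) := evenSub_commute x.2 _
  rw [hx, Dω, Dop_mul, ← Dω, Dω_ωg, map_add, map_mul, map_mul, ← parity_evalKill, hω, map_zero,
    zero_mul, add_zero]
  split_ifs <;> simp

lemma Bω_oddprod_top (hφ : ∀ k, parity g (φ k) = -φ k) (hφ0 : ∀ k, evalKill g notω (φ k) = 0)
    {d : evenSub g} (hd : (oddJacobian hφ).det * d = 1) {f : E} (hf : f ∈ ΛSub g) :
    Bω g (d * (oddprod φ (fun _ => true) * f)) = f := by
  obtain ⟨h, hh⟩ := exists_eq_sum_ωg hφ hφ0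
  have hkill : evenKill g notω h.det = evenKill g notω (oddJacobian hφ).det := by
    rw [AlgHom.map_det, AlgHom.map_det]
    congr 1
    ext j k
    change evalKill g notω (h j k : E) = evalKill g notω (Dω g j (φ k))
    rw [hh, map_sum, map_sum, Finset.sum_eq_single j]
    · rw [evalKill_Dω_smul_ωg, if_pos rfl]
    · exact fun i _ hi => (evalKill_Dω_smul_ωg j i _).trans (if_neg hi.symm)
    · simp
  have hφprod : oddprod φ (fun _ => true) = (h.det : E) * oddprod (ωg g) (fun _ => true) := by
    rw [funext hh]
    exact prod_sum_smul_odd (fun k => parity_basisGen g _) h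
  have hcomm : (d : E) * (oddprod φ (fun _ => true) * f) =
      oddprod (ωg g) (fun _ => true) * ((h.det * d : evenSub g) * f) := by
    rw [hφprod, ← mul_assoc, ← mul_assoc, ← mul_assoc, mul_comm h.det d,
      ← evenSub_commute (d * h.det).2]
    rfl
  have h1 : evalKill g notω ((h.det * d : evenSub g) : E) = 1 := by
    change ((evenKill g notω (h.det * d) : evenSub g) : E) = 1
    rw [map_mul, hkill, ← map_mul, hd, map_one, OneMemClass.coe_one]
  rw [hcomm, Bω_ωpow_mul, map_mul, h1, one_mul, evalKill_eq_self_of_mem_ΛSub g hf fun _ => rfl]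

lemma Bω_oddprod_lower (hφ : ∀ k, parity g (φ k) = -φ k)
    {d : evenSub g} (hd : (oddJacobian hφ).det * d = 1) {f : E} (hf : f ∈ ΛSub g)
    {a : Fin n → Bool} {k : Fin n} (hk : a k = false) :
    Bω g (d * (oddprod φ a * f)) = 0 := by
  set M := oddJacobian hφ with hM
  have hunit : IsUnit M.det := IsUnit.of_mul_eq_one _ hd
  set N := M⁻¹ with hN
  have hMN : M * N = 1 := Matrix.mul_nonsing_inv M hunit
  have hNM : N * M = 1 := Matrix.nonsing_inv_mul M hunit
  have hpiola := piola_identity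
    (fun j => evenDerivation g (Sum.inr (Sum.inr (Sum.inl j)))) hMN
    (fun i j l => Dop_comm g _ _ (φ l)) hd k
  let D : E →ₗ[ℂ] E := ∑ j, LinearMap.mulLeft ℂ (N k j : E) ∘ₗ Dω g j
  have hDapply (x : E) : D x = ∑ j, (N k j : E) * Dω g j x := by
    simp [D, LinearMap.sum_apply]
  have hDmul (x y : E) : D (x * y) = D x * y + parity g x * D y := by
    rw [hDapply, hDapply, hDapply, Finset.sum_mul, Finset.mul_sum, ← Finset.sum_add_distrib]
    refine Finset.sum_congr rfl fun j _ => ?_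
    rw [Dω, Dop_mul, mul_add, mul_assoc, ← mul_assoc (N k j : E) (parity g x),
      evenSub_commute (N k j).2 (parity g x), mul_assoc (parity g x)]
  have hDφ (l : Fin n) : D (φ l) = if k = l then 1 else 0 := by
    have h := congrArg (Subtype.val) (congrFun (congrFun hNM k) l)
    rw [Matrix.mul_apply, AddSubmonoidClass.coe_finsetSum] at h
    rw [hDapply]
    refine Eq.trans h ?_
    rw [Matrix.one_apply]
    split_ifs <;> rfl
  have hD1 : D 1 = 0 := by
    rw [hDapply]
    exact Finset.sum_eq_zero fun j _ => by rw [Dω, Dop_one, mul_zero]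
  have hDf : D f = 0 := by
    rw [hDapply]
    exact Finset.sum_eq_zero fun j _ => by rw [Dω, Dop_eq_zero_of_mem_ΛSub g hf, mul_zero]
  have hDw : D (oddprod φ a * f) = 0 := by
    rw [hDmul, hDf, mul_zero, add_zero, gradedDerivation_oddprod g hDmul hD1, zero_mul]
    intro l hl
    rw [hDφ, if_neg]
    rintro rfl
    simp [hk] at hl
  have hv : D (φ k * (oddprod φ a * f)) = oddprod φ a * f := by
    rw [hDmul, hDw, mul_zero, add_zero, hDφ, if_pos rfl, one_mul]
  have hdiv : (d : E) * (oddprod φ a * f) =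
      ∑ j, Dω g j (((d * N k j : evenSub g) : E) * (φ k * (oddprod φ a * f))) := by
    have h (j : Fin n) : Dω g j (((d * N k j : evenSub g) : E) * (φ k * (oddprod φ a * f))) =
        Dω g j ((d * N k j : evenSub g) : E) * (φ k * (oddprod φ a * f)) +
          (d : E) * ((N k j : E) * Dω g j (φ k * (oddprod φ a * f))) := by
      rw [Dω, Dop_mul, mem_evenSub_iff.mp (d * N k j).2, ← mul_assoc (d : E)]
      rfl
    rw [Finset.sum_congr rfl fun j _ => h j, Finset.sum_add_distrib, ← Finset.sum_mul,
      ← Finset.mul_sum, ← hDapply, hv]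
    have h0 : ∑ j, Dω g j ((d * N k j : evenSub g) : E) = 0 := hpiola
    rw [h0, zero_mul, zero_add]
  rw [hdiv, Bω_sum]
  exact Finset.sum_eq_zero fun j _ => Bω_Dω j _

/-- Change of variables in an odd Berezin integral. -/
lemma Bω_oddJacobian_mul_sum (hφ : ∀ k, parity g (φ k) = -φ k)
    (hφ0 : ∀ k, evalKill g notω (φ k) = 0) {d : E}
    (hd : ((oddJacobian hφ).det : E) * d = 1) (hd' : d * ((oddJacobian hφ).det : E) = 1)
    {f : (Fin n → Bool) → E} (hf : ∀ a, f a ∈ ΛSub g) :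
    Bω g (d * ∑ a, oddprod φ a * f a) = f fun _ => true := by
  have hdeven : d ∈ evenSub g := by
    rw [mem_evenSub_iff, ← mul_one (parity g d), ← hd, ← mul_assoc]
    nth_rw 1 [← mem_evenSub_iff.mp (oddJacobian hφ).det.2]
    rw [← map_mul, hd', map_one, one_mul]
  lift d to evenSub g using hdeven
  have hdR : (oddJacobian hφ).det * d = 1 := Subtype.ext hd
  rw [Finset.mul_sum, Bω_sum, Finset.sum_eq_single fun _ => true]
  · exact Bω_oddprod_top hφ hφ0 hdR (hf _)
  · intro a _ ha
    obtain ⟨k, hk⟩ : ∃ k, a k = false := by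
      by_contra! h
      exact ha (funext fun k => by simpa using h k)
    exact Bω_oddprod_lower hφ hdR (hf a) hk
  · simp

end OddChange

section Continuation

omit [CompleteSpace E]

variable (g : ExteriorAlgebra ℂ (GIdx L n → ℂ) ≃ₐ[ℂ] E)

include g in
lemma finiteDimensional_of_exteriorAlgebra : FiniteDimensional ℂ E := by
  classical
  let : LinearOrder (GIdx L n) := linearOrderOfSTO WellOrderingRel
  have := ((Pi.basisFun ℂ (GIdx L n)).ExteriorAlgebra.map g.toLinearEquiv)
  exact this.finiteDimensional_of_finite

include g in
lemma pd_mem {S : Subalgebra ℂ E} {f : (Fin m → ℝ) → E} (hf : ∀ q, f q ∈ S) (j : Fin m)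
    (q : Fin m → ℝ) : pd j f q ∈ S := by
  have := finiteDimensional_of_exteriorAlgebra g
  unfold pd
  by_cases hd : DifferentiableAt ℝ f q
  · rw [← hd.lineDeriv_eq_fderiv]
    have hmem := range_deriv_subset_closure_span_image
      (fun t : ℝ => f (q + t • Pi.single j 1)) dense_univ ⟨0, rfl⟩
    have hclosed : IsClosed (S : Set E) :=
      Submodule.closed_of_finiteDimensional (Subalgebra.toSubmodule S)
    change deriv (fun t : ℝ => f (q + t • Pi.single j 1)) 0 ∈ (S : Set E)
    suffices h : Submodule.span ℝ ((fun t : ℝ => f (q + t • Pi.single j 1)) '' Set.univ) ≤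
        (Subalgebra.toSubmodule S).restrictScalars ℝ from closure_minimal h hclosed hmem
    rw [Submodule.span_le]
    rintro _ ⟨t, -, rfl⟩
    exact hf _
  · rw [fderiv_zero_of_not_differentiableAt hd]
    exact S.zero_mem

include g in
lemma pdIter_mem {S : Subalgebra ℂ E} (l : List (Fin m)) {f : (Fin m → ℝ) → E}
    (hf : ∀ q, f q ∈ S) (q : Fin m → ℝ) : pdIter l f q ∈ S := by
  induction l generalizing f with
  | nil => exact hf q
  | cons j l ih => exact ih (pd_mem g hf j)

lemma gcont_mem {S : Subalgebra ℂ E} {f : (Fin m → ℝ) → E} (hf : ∀ q, f q ∈ S)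
    {y : Fin m → E} (hy : ∀ i, y i ∈ S) : gcont g f y ∈ S := by
  refine S.sum_mem fun α _ => S.smul_mem (S.mul_mem (pdIter_mem g _ hf _) ?_) _
  refine S.list_prod_mem fun x hx => ?_
  obtain ⟨j, rfl⟩ := (List.mem_ofFn' _ _).mp hx
  exact S.pow_mem (S.sub_mem (hy j) (S.algebraMap_mem _)) _

lemma gcont_zero (y : Fin m → E) : gcont g 0 y = 0 := by
  have h (l : List (Fin m)) : pdIter l (0 : (Fin m → ℝ) → E) = 0 := by
    induction l with
    | nil => rfl
    | cons j l ih =>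
      have : pd j (0 : (Fin m → ℝ) → E) = 0 := by
        funext q
        simp [pd]
      change pdIter l (pd j 0) = 0
      rw [this, ih]
  simp [gcont, h]

omit [NormedAlgebra ℂ E] in
lemma prod_ofFn_zsmul {k : ℕ} (s : Fin k → ℤ) (f : Fin k → E) :
    (List.ofFn fun i => s i • f i).prod = (∏ i, s i) • (List.ofFn f).prod := by
  induction k with
  | zero => simp
  | succ k ih =>
    rw [List.ofFn_succ, List.prod_cons, ih, Fin.prod_univ_succ, List.ofFn_succ, List.prod_cons,
      smul_mul_smul_comm]

lemma parity_ωpow (c : Fin n → Bool) : parity g (ωpow g c) = (-1 : ℤ) ^ mIdxCard c • ωpow g c := by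
  have hprod : ∏ k, (if c k then (-1 : ℤ) else 1) = (-1) ^ mIdxCard c := by
    rw [Finset.prod_ite, Finset.prod_const, Finset.prod_const_one, mul_one, mIdxCard]
  unfold ωpow
  rw [map_list_prod, List.map_ofFn, ← hprod, ← prod_ofFn_zsmul]
  congr 2
  funext k
  have : parity g (ωg g k) = -ωg g k := parity_basisGen g _
  by_cases h : c k <;> simp [h, this]

lemma evalKill_ωpow {c : Fin n → Bool} (hc : mIdxCard c ≠ 0) :
    evalKill g notω (ωpow g c) = 0 := by
  obtain ⟨k, hk⟩ := Finset.card_ne_zero.mp hc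
  have hck : c k = true := by simpa using hk
  unfold ωpow
  rw [map_list_prod, List.map_ofFn]
  refine List.prod_eq_zero ((List.mem_ofFn' _ _).mpr ⟨k, ?_⟩)
  simp only [Function.comp_apply, hck, if_true]
  exact evalKill_basisGen g _ _

variable {g} in
lemma parity_oddSeries {G : (Fin n → Bool) → E} (hGeven : ∀ c, G c ∈ evenSub g)
    (hGodd : ∀ c, mIdxCard c % 2 = 0 → G c = 0) :
    parity g (∑ c, ωpow g c * G c) = -∑ c, ωpow g c * G c := by
  rw [map_sum, ← Finset.sum_neg_distrib]
  refine Finset.sum_congr rfl fun c _ => ?_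
  by_cases hc : mIdxCard c % 2 = 0
  · simp [hGodd c hc]
  · rw [map_mul, mem_evenSub_iff.mp (hGeven c), parity_ωpow,
      (Nat.odd_iff.mpr (Nat.mod_two_ne_zero.mp hc)).neg_one_pow, neg_one_smul, neg_mul]

lemma evalKill_oddSeries {G : (Fin n → Bool) → E}
    (hGodd : ∀ c, mIdxCard c % 2 = 0 → G c = 0) :
    evalKill g notω (∑ c, ωpow g c * G c) = 0 := by
  rw [map_sum]
  refine Finset.sum_eq_zero fun c _ => ?_
  by_cases hc : mIdxCard c % 2 = 0
  · simp [hGodd c hc]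
  · rw [map_mul, evalKill_ωpow g fun h => hc (by rw [h]), zero_mul]

variable {g} in
lemma isUnit_det_oddJacobian {φ : Fin n → E} (hφ : ∀ k, parity g (φ k) = -φ k)
    {B : Matrix (Fin n) (Fin n) E} (hB : ∀ j k, B j k ∈ evenPart g)
    (hinv : (Matrix.of fun j k => evalKill g notω (Dω g j (φ k))) * B = 1) :
    IsUnit (oddJacobian hφ).det := by
  let B' : Matrix (Fin n) (Fin n) (evenSub g) :=
    Matrix.of fun j k => ⟨B j k, (mem_evenPart_iff g).mp (hB j k)⟩
  have h : (evenKill g notω).mapMatrix (oddJacobian hφ) * B' = 1 := by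
    refine Matrix.map_injective Subtype.val_injective ?_
    have h1 := Matrix.map_mul (f := (evenSub g).val)
      (L := (evenKill g notω).mapMatrix (oddJacobian hφ)) (M := B')
    refine (h1.trans hinv).trans ?_
    exact (Matrix.map_one (evenSub g).val (map_zero _) (map_one _)).symm
  refine isUnit_of_isUnit_evenKill g notω ?_
  rw [AlgHom.map_det]
  exact Matrix.isUnit_det_of_right_inverse h

end Continuation

/-- **Change of variables in the odd variables only, with even parameters.**
Let `U ⊆ ℝ^m` be open and `φ_k(y,ω) = Σ_{|c| odd} ω^c g̃_{k,c}(y)` (coefficients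
`g_{k,c} ∈ C^∞(U,Λ)` of parity `|c|+1`), with the matrix `((∂_{ω_j}φ_k)|_{ω=0})` invertible
(over the even part) at every point `y` of the superdomain over `U`.  Then `(∂_{ω_j}φ_k)`
is invertible over the even part and, for every supersmooth `u(x,θ) = Σ_a θ^a f̃_a(x)` and
every point `y`, `∫dθ u(y,θ) = ∫dω (det ∂φ/∂ω)⁻¹·u(y,φ(y,ω))`; consequently, whenever the
coefficient functions are integrable, `∬ dxdθ u = ∬ dydω (det ∂φ/∂ω)⁻¹·u(y,φ(y,ω))` for the
naive Berezin integral. -/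
theorem berezin_odd_change_with_even_parameters
    (g : ExteriorAlgebra ℂ (GIdx L n → ℂ) ≃ₐ[ℂ] E)
    (U : Set (Fin m → ℝ)) (hUopen : IsOpen U)
    (gk : Fin n → (Fin n → Bool) → (Fin m → ℝ) → E)
    (hgksmooth : ∀ k c, ContDiffOn ℝ (⊤ : ℕ∞) (gk k c) U)
    (hgkΛ : ∀ k c q, gk k c q ∈ ΛSub g)
    (hgkparity : ∀ k c q,
      gk k c q ∈ (if mIdxCard c % 2 = 0 then oddPart g else evenPart g))
    (hgkodd : ∀ k c, mIdxCard c % 2 = 0 → gk k c = 0)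
    (hbodyinv : ∀ y : Fin m → E,
      (∀ i, y i ∈ ΛSub g ∧ y i ∈ evenPart g ∧ (πB g (y i)).im = 0) → bodyVec g y ∈ U →
      ∃ Bm : Matrix (Fin n) (Fin n) E, (∀ j k, Bm j k ∈ evenPart g) ∧
        (Matrix.of fun j k =>
          evalKill g notω (Dω g j (∑ c : Fin n → Bool, ωpow g c * gcont g (gk k c) y)))
            * Bm = 1 ∧
        Bm * (Matrix.of fun j k =>
          evalKill g notω (Dω g j (∑ c : Fin n → Bool, ωpow g c * gcont g (gk k c) y)))
            = 1)
    (F : (Fin n → Bool) → (Fin m → ℝ) → E)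
    (hFsmooth : ∀ a, ContDiffOn ℝ (⊤ : ℕ∞) (F a) U)
    (hFΛ : ∀ a q, F a q ∈ ΛSub g) :
    -- invertibility of `(∂_{ω_j} φ_k)` over the even part
    (∀ y : Fin m → E,
      (∀ i, y i ∈ ΛSub g ∧ y i ∈ evenPart g ∧ (πB g (y i)).im = 0) → bodyVec g y ∈ U →
      ∃ Cm : Matrix (Fin n) (Fin n) E, (∀ j k, Cm j k ∈ evenPart g) ∧
        (Matrix.of fun j k =>
            Dω g j (∑ c : Fin n → Bool, ωpow g c * gcont g (gk k c) y)) * Cm = 1 ∧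
        Cm * (Matrix.of fun j k =>
            Dω g j (∑ c : Fin n → Bool, ωpow g c * gcont g (gk k c) y)) = 1)
    -- pointwise change-of-variables identity for the odd integral
    ∧ (∀ y : Fin m → E,
        (∀ i, y i ∈ ΛSub g ∧ y i ∈ evenPart g ∧ (πB g (y i)).im = 0) → bodyVec g y ∈ U →
        ∀ d : E,
          detE (Matrix.of fun j k =>
            Dω g j (∑ c : Fin n → Bool, ωpow g c * gcont g (gk k c) y)) * d = 1 →
          d * detE (Matrix.of fun j k =>
            Dω g j (∑ c : Fin n → Bool, ωpow g c * gcont g (gk k c) y)) = 1 →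
          Bθ g (∑ a : Fin n → Bool, θpow g a * gcont g (F a) y)
            = Bω g (d * ∑ a : Fin n → Bool,
                oddprod (fun k => ∑ c : Fin n → Bool, ωpow g c * gcont g (gk k c) y) a
                  * gcont g (F a) y))
    -- the integrated (naive Berezin) change-of-variables formula
    ∧ (∀ dq : (Fin m → ℝ) → E,
        (∀ q ∈ U,
          detE (Matrix.of fun j k =>
            Dω g j (∑ c : Fin n → Bool,
              ωpow g c * gcont g (gk k c) (fun i => algebraMap ℂ E ((q i : ℂ))))) * dq q = 1
          ∧ dq q * detE (Matrix.of fun j k =>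
            Dω g j (∑ c : Fin n → Bool,
              ωpow g c * gcont g (gk k c) (fun i => algebraMap ℂ E ((q i : ℂ))))) = 1) →
        IntegrableOn (fun q => F (fun _ => true) q) U volume →
        IntegrableOn (fun q => Bω g (dq q * ∑ a : Fin n → Bool,
            oddprod (fun k => ∑ c : Fin n → Bool,
              ωpow g c * gcont g (gk k c) (fun i => algebraMap ℂ E ((q i : ℂ)))) a
              * F a q)) U volume →
        (∫ q in U, F (fun _ => true) q)
          = ∫ q in U, Bω g (dq q * ∑ a : Fin n → Bool,
              oddprod (fun k => ∑ c : Fin n → Bool,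
                ωpow g c * gcont g (gk k c) (fun i => algebraMap ℂ E ((q i : ℂ)))) a
                * F a q)) := by
  have hpar (y : Fin m → E)
      (hy : ∀ i, y i ∈ ΛSub g ∧ y i ∈ evenPart g ∧ (πB g (y i)).im = 0) (k : Fin n) :
      parity g (∑ c : Fin n → Bool, ωpow g c * gcont g (gk k c) y) =
        -∑ c : Fin n → Bool, ωpow g c * gcont g (gk k c) y := by
    refine parity_oddSeries (fun c => ?_) fun c hc => by rw [hgkodd k c hc, gcont_zero]
    by_cases hc : mIdxCard c % 2 = 0
    · rw [hgkodd k c hc, gcont_zero]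
      exact Subalgebra.zero_mem _
    · refine gcont_mem g (fun q => ?_) fun i => (mem_evenPart_iff g).mp (hy i).2.1
      have := hgkparity k c q
      rw [if_neg hc] at this
      exact (mem_evenPart_iff g).mp this
  have hkill (y : Fin m → E) (k : Fin n) :
      evalKill g notω (∑ c : Fin n → Bool, ωpow g c * gcont g (gk k c) y) = 0 :=
    evalKill_oddSeries g fun c hc => by rw [hgkodd k c hc, gcont_zero]
  refine ⟨fun y hy hyU => ?_, fun y hy hyU d hd hd' => ?_, fun dq hdq _ _ => ?_⟩
  · obtain ⟨B, hB, hinv, -⟩ := hbodyinv y hy hyU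
    have hunit := isUnit_det_oddJacobian (hpar y hy) hB hinv
    set M := oddJacobian (hpar y hy)
    have hmap (P Q : Matrix (Fin n) (Fin n) (evenSub g)) (h : P * Q = 1) :
        P.map (evenSub g).val * Q.map (evenSub g).val = 1 := by
      rw [← Matrix.map_mul, h]
      exact Matrix.map_one _ (map_zero _) (map_one _)
    exact ⟨M⁻¹.map (evenSub g).val, fun j k => (mem_evenPart_iff g).mpr (M⁻¹ j k).2,
      hmap M M⁻¹ (Matrix.mul_nonsing_inv M hunit), hmap M⁻¹ M (Matrix.nonsing_inv_mul M hunit)⟩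
  · have hF (a : Fin n → Bool) : gcont g (F a) y ∈ ΛSub g :=
      gcont_mem g (hFΛ a) fun i => (hy i).1
    rw [Bθ_sum_θpow_mul g hF]
    have hdet := detE_coe g (oddJacobian (hpar y hy))
    exact (Bω_oddJacobian_mul_sum (hpar y hy) (hkill y) (hdet ▸ hd) (hdet ▸ hd') hF).symm
  · refine setIntegral_congr_fun hUopen.measurableSet fun q hq => ?_
    have hy (i : Fin m) : algebraMap ℂ E (q i : ℂ) ∈ ΛSub g ∧
        algebraMap ℂ E (q i : ℂ) ∈ evenPart g ∧ (πB g (algebraMap ℂ E (q i : ℂ))).im = 0 :=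
      ⟨Subalgebra.algebraMap_mem _ _, (mem_evenPart_iff g).mpr (by simp), by simp⟩
    have hdet := detE_coe g (oddJacobian (hpar _ hy))
    exact (Bω_oddJacobian_mul_sum (hpar _ hy) (hkill _) (hdet ▸ (hdq q hq).1)
      (hdet ▸ (hdq q hq).2) fun a => hFΛ a q).symm
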